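/- Let H be a real inner product space, let θ* ∈ H, and let μ > 0, σ ≥ 0, η > 0 with η·μ < 1. Let (Ω, P) be a probability space and let Θₜ : Ω → H and gₜ : Ω → H (t ∈ ℕ) be random vectors such that Θ_{t+1} = Θₜ − η·gₜ pointwise, the functions ω ↦ ‖Θₜ(ω) − θ*‖², ω ↦ ‖gₜ(ω)‖², and ω ↦ ⟪gₜ(ω), Θₜ(ω) − θ*⟫ are integrable for every t, and for every t one has E[⟪gₜ, Θₜ − θ*⟫] ≥ μ·E[‖Θₜ − θ*‖²] and E[‖gₜ‖²] ≤ μ²·E[‖Θₜ − θ*‖²] + σ². Then for every t ∈ ℕ: E[‖Θₜ − θ*‖²] ≤ (1 − η·μ)ᵗ · E[‖Θ₀ − θ*‖²] + η·σ²/μ. -/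

import Mathlib

open MeasureTheory RealInnerProductSpace

/-- Theorem 3.1 (Convergence Rate), core bound: under the expected correlation lower bound
and second-moment upper bound on the stochastic gradients, SGD iterates satisfy
`E‖Θₜ − θ*‖² ≤ (1 − ημ)ᵗ E‖Θ₀ − θ*‖² + ησ²/μ`. -/
theorem sgd_convergence_rate
    {H : Type*} [NormedAddCommGroup H] [InnerProductSpace ℝ H]
    {Ω : Type*} [MeasurableSpace Ω] (P : Measure Ω) [IsProbabilityMeasure P]
    (θstar : H) (μ σ η : ℝ) (hμ : 0 < μ) (hσ : 0 ≤ σ) (hη : 0 < η) (hημ : η * μ < 1)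
    (Θ g : ℕ → Ω → H)
    (hstep : ∀ t ω, Θ (t + 1) ω = Θ t ω - η • g t ω)
    (hint1 : ∀ t, Integrable (fun ω => ‖Θ t ω - θstar‖ ^ 2) P)
    (hint2 : ∀ t, Integrable (fun ω => ‖g t ω‖ ^ 2) P)
    (hint3 : ∀ t, Integrable (fun ω => ⟪g t ω, Θ t ω - θstar⟫) P)
    (hcorr : ∀ t, μ * ∫ ω, ‖Θ t ω - θstar‖ ^ 2 ∂P ≤ ∫ ω, ⟪g t ω, Θ t ω - θstar⟫ ∂P)
    (hmom : ∀ t, ∫ ω, ‖g t ω‖ ^ 2 ∂P ≤ μ ^ 2 * ∫ ω, ‖Θ t ω - θstar‖ ^ 2 ∂P + σ ^ 2) :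
    ∀ t : ℕ, ∫ ω, ‖Θ t ω - θstar‖ ^ 2 ∂P ≤
      (1 - η * μ) ^ t * ∫ ω, ‖Θ 0 ω - θstar‖ ^ 2 ∂P + η * σ ^ 2 / μ := by
  have hrec : ∀ t : ℕ, ∫ ω, ‖Θ (t + 1) ω - θstar‖ ^ 2 ∂P ≤
      (1 - η * μ) * ∫ ω, ‖Θ t ω - θstar‖ ^ 2 ∂P + η ^ 2 * σ ^ 2 := by
    intro t
    have hpt : ∀ ω, ‖Θ (t + 1) ω - θstar‖ ^ 2 =
        ‖Θ t ω - θstar‖ ^ 2 - 2 * η * ⟪g t ω, Θ t ω - θstar⟫ + η ^ 2 * ‖g t ω‖ ^ 2 := by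
      intro ω
      have h1 : Θ (t + 1) ω - θstar = (Θ t ω - θstar) - η • g t ω := by
        rw [hstep]; abel
      rw [h1, norm_sub_sq_real, inner_smul_right, norm_smul, real_inner_comm, mul_pow,
        Real.norm_eq_abs, sq_abs]
      ring
    have hexp : ∫ ω, ‖Θ (t + 1) ω - θstar‖ ^ 2 ∂P =
        ∫ ω, ‖Θ t ω - θstar‖ ^ 2 ∂P - 2 * η * ∫ ω, ⟪g t ω, Θ t ω - θstar⟫ ∂P
          + η ^ 2 * ∫ ω, ‖g t ω‖ ^ 2 ∂P := by
      simp_rw [hpt]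
      have hs : Integrable
          (fun ω => ‖Θ t ω - θstar‖ ^ 2 - 2 * η * ⟪g t ω, Θ t ω - θstar⟫) P :=
        (hint1 t).sub ((hint3 t).const_mul _)
      rw [integral_add hs ((hint2 t).const_mul _),
        integral_sub (hint1 t) ((hint3 t).const_mul _), integral_const_mul, integral_const_mul]
    rw [hexp]
    have ha : 0 ≤ ∫ ω, ‖Θ t ω - θstar‖ ^ 2 ∂P := integral_nonneg fun ω => sq_nonneg _
    have hc := mul_le_mul_of_nonneg_left (hcorr t) (by positivity : 0 ≤ 2 * η)
    have hm := mul_le_mul_of_nonneg_left (hmom t) (by positivity : 0 ≤ η ^ 2)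
    have hk := mul_nonneg (mul_nonneg (mul_pos hη hμ).le (sub_nonneg.2 hημ.le)) ha
    linarith
  intro t
  induction t with
  | zero =>
    have : 0 ≤ η * σ ^ 2 / μ := by positivity
    simpa using this
  | succ t ih =>
    have h := mul_le_mul_of_nonneg_left ih (sub_nonneg.2 hημ.le)
    have e : (1 - η * μ) * (η * σ ^ 2 / μ) + η ^ 2 * σ ^ 2 = η * σ ^ 2 / μ := by
      field_simp
      ring
    rw [pow_succ]
    linarith [hrec t]
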